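/- Cauer's estimate for Lamé curves: let k ≥ 3 be an integer, let A(x; L_k) = #{(m,n) ∈ ℤ² : |m|^k + |n|^k ≤ x^k}, and set Δ(x; L_k) = A(x; L_k) − (2/k)·(Γ(1/k)²/Γ(2/k))·x². Then Δ(x; L_k) = O( x^{1 − 1/(2k−1)} ) as x → ∞. -/

import Mathlib

open Real Filter Asymptotics

/-- The number of integer lattice points inside and on the dilated Lamé curve
`|t₁|^k + |t₂|^k = x^k`. -/
noncomputable def lameA (k : ℕ) (x : ℝ) : ℕ :=
  {q : ℤ × ℤ | |(q.1 : ℝ)| ^ k + |(q.2 : ℝ)| ^ k ≤ x ^ k}.ncard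

/-- The lattice point discrepancy of the dilated Lamé domain. -/
noncomputable def lameDelta (k : ℕ) (x : ℝ) : ℝ :=
  (lameA k x : ℝ) -
    (2 / k) * (Real.Gamma (1 / k) ^ 2 / Real.Gamma (2 / k)) * x ^ 2

/-- The sawtooth function `y - ⌊y⌋ - 1/2`. -/
noncomputable def sawtooth (y : ℝ) : ℝ := Int.fract y - 1 / 2

lemma abs_sawtooth_le (y : ℝ) : |sawtooth y| ≤ 1 / 2 := by
  have h0 := Int.fract_nonneg y
  have h1 := Int.fract_lt_one y
  rw [sawtooth, abs_le]
  constructor <;> linarith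

lemma abs_sum_sawtooth_le (s : Finset ℕ) (y : ℕ → ℝ) :
    |∑ m ∈ s, sawtooth (y m)| ≤ s.card / 2 := by
  refine (Finset.abs_sum_le_sum_abs _ _).trans ?_
  refine (Finset.sum_le_card_nsmul _ _ _ fun m _ => abs_sawtooth_le (y m)).trans_eq ?_
  rw [nsmul_eq_mul]
  ring

lemma sawtooth_le_of_abs_sub_le {y z ε : ℝ} (h : |y - z| ≤ ε) :
    sawtooth y ≤ sawtooth (z - ε) + 2 * ε := by
  have h2 := abs_le.1 h
  have : (⌊z - ε⌋ : ℝ) ≤ ⌊y⌋ := by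
    exact_mod_cast Int.floor_le_floor (by linarith)
  simp only [sawtooth, Int.fract]
  linarith

lemma le_sawtooth_of_abs_sub_le {y z ε : ℝ} (h : |y - z| ≤ ε) :
    sawtooth (z + ε) - 2 * ε ≤ sawtooth y := by
  have h2 := abs_le.1 h
  have : (⌊y⌋ : ℝ) ≤ ⌊z + ε⌋ := by
    exact_mod_cast Int.floor_le_floor (by linarith)
  simp only [sawtooth, Int.fract]
  linarith

/-- An arithmetic progression with step coprime to `q` runs through a complete residue system. -/
lemma sum_emod_of_isCoprime {p : ℤ} {q : ℕ} (hq : 0 < q) (hpq : IsCoprime p q) (b : ℤ) :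
    ∑ j ∈ Finset.range q, ((((b + j * p) % q : ℤ)) : ℝ) = q * (q - 1) / 2 := by
  have hq' : (0 : ℤ) < q := by exact_mod_cast hq
  have hmaps : ∀ j ∈ Finset.range q, ((b + j * p) % q).toNat ∈ Finset.range q := by
    intro j _
    have h1 := Int.emod_nonneg (b + j * p) hq'.ne'
    have h2 := Int.emod_lt_of_pos (b + j * p) hq'
    rw [Finset.mem_range]
    omega
  have hinj : Set.InjOn (fun j : ℕ => ((b + j * p) % q).toNat) (Finset.range q) := by
    intro i hi j hj hij
    simp only [Finset.coe_range, Set.mem_Iio] at hi hj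
    have h1 := Int.emod_nonneg (b + i * p) hq'.ne'
    have h2 := Int.emod_nonneg (b + j * p) hq'.ne'
    have h3 : (b + i * p) % q = (b + j * p) % q := by
      simp only at hij
      omega
    have h4 : (q : ℤ) ∣ (b + i * p) - (b + j * p) := Int.ModEq.dvd (Int.ModEq.symm h3)
    have h5 : (q : ℤ) ∣ ((i : ℤ) - j) * p := by
      have : (b + i * p) - (b + j * p) = ((i : ℤ) - j) * p := by ring
      rwa [this] at h4
    have h6 : (q : ℤ) ∣ (i : ℤ) - j := hpq.symm.dvd_of_dvd_mul_right h5
    have h7 := Int.eq_zero_of_abs_lt_dvd h6 (by rw [abs_lt]; constructor <;> omega)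
    omega
  have himg : (Finset.range q).image (fun j : ℕ => ((b + j * p) % q).toNat) = Finset.range q :=
    Finset.eq_of_subset_of_card_le (Finset.image_subset_iff.2 hmaps)
      (by rw [Finset.card_image_of_injOn hinj])
  have h1 : ∑ j ∈ Finset.range q, ((((b + j * p) % q : ℤ)) : ℝ)
      = ∑ j ∈ Finset.range q, ((((b + j * p) % q).toNat : ℕ) : ℝ) := by
    refine Finset.sum_congr rfl fun j _ => ?_
    have h1 := Int.toNat_of_nonneg (Int.emod_nonneg (b + j * p) hq'.ne')
    exact_mod_cast h1.symm
  rw [h1, ← Finset.sum_image (f := fun n : ℕ => (n : ℝ)) hinj, himg]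
  have := Finset.sum_range_id_mul_two q
  have h2 : ((∑ i ∈ Finset.range q, i : ℕ) : ℝ) * 2 = q * (q - 1) := by
    rw [← Nat.cast_pred hq]
    exact_mod_cast this
  push_cast at h2
  linarith

lemma abs_sum_sawtooth_progression_le {p : ℤ} {q : ℕ} (hq : 0 < q) (hpq : IsCoprime p q)
    (c : ℝ) : |∑ j ∈ Finset.range q, sawtooth (c + j * (p / q))| ≤ 1 / 2 := by
  have hq0 : (0 : ℝ) < q := by exact_mod_cast hq
  set b := ⌊q * c⌋ with hb
  have hterm : ∀ j : ℕ, sawtooth (c + j * (p / q))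
      = ((((b + j * p) % q : ℤ) : ℝ) + Int.fract (q * c)) / q - 1 / 2 := by
    intro j
    have hdm : (((b + j * p) % q : ℤ) : ℝ) + q * ((b + j * p) / q : ℤ) = b + j * p := by
      exact_mod_cast Int.emod_add_mul_ediv (b + j * p) q
    have h1 : (0 : ℝ) ≤ ((b + j * p) % q : ℤ) := by
      exact_mod_cast Int.emod_nonneg (b + j * p) (by omega)
    have h2 : (((b + j * p) % q : ℤ) : ℝ) + 1 ≤ q := by
      exact_mod_cast Int.emod_lt_of_pos (b + j * p) (by omega : (0 : ℤ) < q)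
    have h3 := Int.fract_nonneg (q * c)
    have h4 := Int.fract_lt_one (q * c)
    have h5 : (b : ℝ) + Int.fract (q * c) = q * c := Int.floor_add_fract _
    have h6 : c + j * (p / q) = ((b + j * p) / q : ℤ)
        + ((((b + j * p) % q : ℤ) : ℝ) + Int.fract (q * c)) / q := by
      clear_value b
      generalize Int.fract (q * c) = θ at h5
      field_simp
      linarith
    rw [sawtooth, h6, Int.fract_intCast_add, Int.fract_eq_self.2]
    constructor
    · positivity
    · rw [div_lt_one hq0]
      linarith
  simp only [hterm]
  rw [Finset.sum_sub_distrib, ← Finset.sum_div, Finset.sum_add_distrib,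
    sum_emod_of_isCoprime hq hpq]
  have h3 := Int.fract_nonneg (q * c)
  have h4 := Int.fract_lt_one (q * c)
  simp only [Finset.sum_const, Finset.card_range, nsmul_eq_mul]
  have : (q * (q - 1) / 2 + q * Int.fract (q * c)) / q - q * (1 / 2)
      = Int.fract (q * c) - 1 / 2 := by
    field_simp
    ring
  rw [this, abs_le]
  constructor <;> linarith

/-- The sawtooth sum over one period of a sequence close to an arithmetic progression. -/
lemma abs_sum_sawtooth_near_progression_le {p : ℤ} {q : ℕ} (hq : 0 < q) (hpq : IsCoprime p q)
    {c ε : ℝ} {y : ℕ → ℝ} (hy : ∀ j < q, |y j - (c + j * (p / q))| ≤ ε) :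
    |∑ j ∈ Finset.range q, sawtooth (y j)| ≤ 1 / 2 + 2 * q * ε := by
  have hlo := (abs_le.1 (abs_sum_sawtooth_progression_le hq hpq (c + ε))).1
  have hhi := (abs_le.1 (abs_sum_sawtooth_progression_le hq hpq (c - ε))).2
  have h1 : ∑ j ∈ Finset.range q, sawtooth (y j)
      ≤ ∑ j ∈ Finset.range q, (sawtooth (c - ε + j * (p / q)) + 2 * ε) := by
    refine Finset.sum_le_sum fun j hj => ?_
    have := sawtooth_le_of_abs_sub_le (hy j (Finset.mem_range.1 hj))
    rwa [show c - ε + j * (p / q) = c + j * (p / q) - ε by ring]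
  have h2 : ∑ j ∈ Finset.range q, (sawtooth (c + ε + j * (p / q)) - 2 * ε)
      ≤ ∑ j ∈ Finset.range q, sawtooth (y j) := by
    refine Finset.sum_le_sum fun j hj => ?_
    have := le_sawtooth_of_abs_sub_le (hy j (Finset.mem_range.1 hj))
    rwa [show c + ε + j * (p / q) = c + j * (p / q) + ε by ring]
  rw [Finset.sum_add_distrib] at h1
  rw [Finset.sum_sub_distrib] at h2
  simp only [Finset.sum_const, Finset.card_range, nsmul_eq_mul] at h1 h2
  rw [abs_le]
  constructor <;> linarith

/-- Greedy tiling of `[A, B)` by blocks `[m, m + q m)`, with an incomplete last block. -/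
lemma exists_greedy_tiling (a : ℕ → ℝ) (q : ℕ → ℕ) (Q : ℕ) {K : ℝ} (hq : ∀ m, 0 < q m)
    (hqQ : ∀ m, q m ≤ Q) (ha : ∀ m, |a m| ≤ 1) (A B : ℕ)
    (hK : ∀ m, A ≤ m → m + q m ≤ B → |∑ j ∈ Finset.range (q m), a (m + j)| ≤ K) :
    ∃ S ⊆ Finset.Ico A B, (∀ s ∈ S, ∀ t ∈ S, s < t → s + q s ≤ t) ∧
      |∑ m ∈ Finset.Ico A B, a m| ≤ K * S.card + Q := by
  induction h : B - A using Nat.strong_induction_on generalizing A with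
  | _ n ih =>
    have hpos := hq A
    by_cases hAB : A + q A ≤ B
    · obtain ⟨S, hS, hsp, hsum⟩ := ih (B - (A + q A)) (by omega) (A + q A)
        (fun m hm => hK m (by omega)) rfl
      have hAS : A ∉ S := fun hA => by
        have := Finset.mem_Ico.1 (hS hA)
        omega
      refine ⟨insert A S, ?_, ?_, ?_⟩
      · refine Finset.insert_subset (Finset.mem_Ico.2 (by omega)) (hS.trans ?_)
        exact Finset.Ico_subset_Ico_left (by omega)
      · intro s hs t ht hst
        rw [Finset.mem_insert] at hs ht
        rcases hs with rfl | hs <;> rcases ht with rfl | ht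
        · omega
        · exact (Finset.mem_Ico.1 (hS ht)).1
        · have := (Finset.mem_Ico.1 (hS hs)).1
          omega
        · exact hsp s hs t ht hst
      · rw [← Finset.sum_Ico_consecutive a (by omega : A ≤ A + q A) hAB,
          Finset.card_insert_of_notMem hAS, Finset.sum_Ico_eq_sum_range]
        have h1 := hK A le_rfl hAB
        rw [Nat.add_sub_cancel_left]
        have h2 := abs_add_le (∑ j ∈ Finset.range (q A), a (A + j))
          (∑ m ∈ Finset.Ico (A + q A) B, a m)
        push_cast
        linarith
    · refine ⟨∅, Finset.empty_subset _, by simp, ?_⟩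
      have h1 := (Finset.abs_sum_le_sum_abs a (Finset.Ico A B)).trans
        (Finset.sum_le_card_nsmul _ _ _ fun m _ => ha m)
      rw [Nat.card_Ico, nsmul_eq_mul, mul_one] at h1
      have h2 : ((B - A : ℕ) : ℝ) ≤ Q := by
        have := hqQ A
        exact_mod_cast (by omega : B - A ≤ Q)
      simpa using h1.trans h2

lemma card_le_of_separated {S : Finset ℕ} {q : ℕ} (hq : 0 < q) {D : ℝ} (hD : 0 ≤ D)
    (hS : ∀ s ∈ S, ∀ t ∈ S, s < t → s + q ≤ t ∧ (t : ℝ) - s ≤ D) :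
    (S.card : ℝ) ≤ 1 + D / q := by
  have hq0 : (0 : ℝ) < q := by exact_mod_cast hq
  rcases S.eq_empty_or_nonempty with rfl | hne
  · simp only [Finset.card_empty, Nat.cast_zero]
    positivity
  set a := S.min' hne
  have haS : a ∈ S := S.min'_mem hne
  have ha : ∀ s ∈ S, a ≤ s := fun s hs => S.min'_le s hs
  have hmaps : ∀ s ∈ S, (s - a) / q ∈ Finset.range (⌊D / q⌋₊ + 1) := by
    intro s hs
    rw [Finset.mem_range, Nat.lt_succ_iff]
    refine Nat.le_floor ?_
    refine Nat.cast_div_le.trans ?_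
    gcongr
    rw [Nat.cast_sub (ha s hs)]
    rcases (ha s hs).eq_or_lt with h | h
    · rw [← h]
      simpa using hD
    · exact (hS a haS s hs h).2
  have hinj : Set.InjOn (fun s => (s - a) / q) S := by
    have key : ∀ s ∈ S, ∀ t ∈ S, s < t → (s - a) / q < (t - a) / q := by
      intro s hs t ht hst
      have h1 := (hS s hs t ht hst).1
      have h2 := ha s hs
      calc (s - a) / q < (s - a) / q + 1 := Nat.lt_succ_self _
        _ = (s - a + q) / q := (Nat.add_div_right _ hq).symm
        _ ≤ (t - a) / q := Nat.div_le_div_right (by omega)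
    intro s hs t ht hst
    rcases lt_trichotomy s t with h | h | h
    · exact absurd hst (key s hs t ht h).ne
    · exact h
    · exact absurd hst (key t ht s hs h).ne'
  have hcard := Finset.card_le_card_of_injOn _ hmaps hinj
  rw [Finset.card_range] at hcard
  have h1 : (S.card : ℝ) ≤ ⌊D / q⌋₊ + 1 := by exact_mod_cast hcard
  have h2 := Nat.floor_le (by positivity : 0 ≤ D / q)
  linarith

lemma sum_Icc_inv_sq_le_two (n : ℕ) : ∑ q ∈ Finset.Icc 1 n, ((q : ℝ) ^ 2)⁻¹ ≤ 2 := by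
  have h : Finset.Icc 1 n = Finset.Ioo 0 (n + 1) := by
    ext
    simp only [Finset.mem_Icc, Finset.mem_Ioo]
    omega
  rw [h]
  simpa using sum_Ioo_inv_sq_le (α := ℝ) 0 (n + 1)

lemma sum_Icc_inv_le_log (n : ℕ) : ∑ q ∈ Finset.Icc 1 n, (q : ℝ)⁻¹ ≤ 1 + Real.log n := by
  have := harmonic_le_one_add_log n
  rw [harmonic_eq_sum_Icc] at this
  push_cast at this
  exact this

/-- Counting the blocks of a tiling by the rational approximations of the slopes at their left
endpoints. -/
lemma card_tiling_le {S : Finset ℕ} {g : ℕ → ℝ} {r : ℕ → ℚ} {Q : ℕ} {G R l : ℝ} (hl : 0 < l)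
    (hR : 0 ≤ R) (hg : ∀ s ∈ S, G ≤ g s ∧ g s ≤ G + R)
    (hr : ∀ s ∈ S, |g s - r s| ≤ 1 / ((Q + 1) * (r s).den)) (hrQ : ∀ s ∈ S, (r s).den ≤ Q)
    (hsp : ∀ s ∈ S, ∀ t ∈ S, s < t → s + (r s).den ≤ t)
    (hmono : ∀ s ∈ S, ∀ t ∈ S, s < t → l * (t - s) ≤ g s - g t) :
    (S.card : ℝ) ≤ R * Q ^ 2 + 3 * Q + 2 / ((Q + 1) * l) * (R * (1 + Real.log Q) + 6) := by
  classical
  set E : ℝ := 2 / ((Q + 1) * l) with hE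
  have hE0 : 0 ≤ E := by positivity
  set P : Finset (Σ _ : ℕ, ℤ) := (Finset.Icc 1 Q).sigma
    fun q => Finset.Icc ⌈q * G - 1⌉ ⌊q * (G + R) + 1⌋ with hP
  have hmem : ∀ s ∈ S, (⟨(r s).den, (r s).num⟩ : Σ _ : ℕ, ℤ) ∈ P := by
    intro s hs
    have hd : (0 : ℝ) < (r s).den := by exact_mod_cast (r s).den_pos
    rw [hP, Finset.mem_sigma, Finset.mem_Icc, Finset.mem_Icc]
    refine ⟨⟨(r s).den_pos, hrQ s hs⟩, ?_⟩
    have h1 : |(r s).den * g s - (r s).num| ≤ 1 := by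
      have h2 : (r s).den * g s - (r s).num = (r s).den * (g s - r s) := by
        rw [mul_sub]
        congr 1
        have := Rat.den_mul_eq_num (r s)
        exact_mod_cast this.symm
      rw [h2, abs_mul, abs_of_pos hd]
      calc (r s).den * |g s - r s| ≤ (r s).den * (1 / ((Q + 1) * (r s).den)) := by
            gcongr
            exact hr s hs
        _ = 1 / (Q + 1) := by field_simp
        _ ≤ 1 := by
            rw [div_le_one (by positivity)]
            linarith [(Nat.cast_nonneg Q : (0 : ℝ) ≤ Q)]
    have h3 := abs_le.1 h1
    have h4 := mul_le_mul_of_nonneg_left (hg s hs).1 hd.le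
    have h5 := mul_le_mul_of_nonneg_left (hg s hs).2 hd.le
    constructor
    · rw [Int.ceil_le]
      linarith
    · rw [Int.le_floor]
      linarith
  have hfib : ∀ x ∈ P,
      (((S.filter fun s => (⟨(r s).den, (r s).num⟩ : Σ _ : ℕ, ℤ) = x).card : ℕ) : ℝ)
      ≤ 1 + E * ((x.1 : ℝ) ^ 2)⁻¹ := by
    rintro ⟨q, p⟩ hx
    rw [hP, Finset.mem_sigma, Finset.mem_Icc] at hx
    have hq : 0 < q := hx.1.1
    have hq0 : (0 : ℝ) < q := by exact_mod_cast hq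
    have key := card_le_of_separated (S := S.filter fun s =>
      (⟨(r s).den, (r s).num⟩ : Σ _ : ℕ, ℤ) = ⟨q, p⟩) hq (D := E / q) (by positivity) ?_
    · refine key.trans_eq ?_
      simp only
      field_simp
    · intro s hs t ht hst
      simp only [Finset.mem_filter, Sigma.mk.injEq, heq_eq_eq] at hs ht
      obtain ⟨hs, hsq, hsp'⟩ := hs
      obtain ⟨ht, htq, htp⟩ := ht
      have hrr : r s = r t := Rat.ext (hsp'.trans htp.symm) (hsq.trans htq.symm)
      refine ⟨hsq ▸ hsp s hs t ht hst, ?_⟩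
      have h1 := abs_le.1 (hr s hs)
      have h2 := abs_le.1 (hr t ht)
      have h3 := hmono s hs t ht hst
      rw [hrr, htq] at h1
      rw [htq] at h2
      have h4 : l * ((t : ℝ) - s) ≤ 2 * (1 / ((Q + 1) * q)) := by linarith
      have h5 : E / q = 2 * (1 / ((Q + 1) * q)) / l := by
        rw [hE]
        field_simp
      rw [h5, le_div_iff₀ hl]
      linarith
  have hcard : (S.card : ℝ) ≤ ∑ x ∈ P, (1 + E * ((x.1 : ℝ) ^ 2)⁻¹) := by
    rw [Finset.card_eq_sum_card_fiberwise (s := S) (t := P)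
      (f := fun s => (⟨(r s).den, (r s).num⟩ : Σ _ : ℕ, ℤ)) hmem]
    push_cast
    exact Finset.sum_le_sum hfib
  have hwidth : ∀ q : ℕ, ((Finset.Icc ⌈q * G - 1⌉ ⌊q * (G + R) + 1⌋).card : ℝ) ≤ q * R + 3 := by
    intro q
    rw [Int.card_Icc]
    have h1 := Int.le_ceil (q * G - 1)
    have h2 := Int.floor_le (q * (G + R) + 1)
    have h3 : (0 : ℝ) ≤ q * R := by positivity
    have h4 : ((⌊q * (G + R) + 1⌋ + 1 - ⌈q * G - 1⌉ : ℤ) : ℝ) ≤ q * R + 3 := by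
      push_cast
      linarith
    rcases le_total 0 (⌊q * (G + R) + 1⌋ + 1 - ⌈q * G - 1⌉) with h | h
    · have h5 := Int.toNat_of_nonneg h
      have h6 : (((⌊q * (G + R) + 1⌋ + 1 - ⌈q * G - 1⌉).toNat : ℤ) : ℝ) ≤ q * R + 3 := by
        rw [h5]
        exact h4
      exact_mod_cast h6
    · rw [Int.toNat_eq_zero.2 h]
      push_cast
      linarith
  refine hcard.trans ?_
  rw [hP, Finset.sum_sigma]
  simp only [Finset.sum_const, nsmul_eq_mul]
  calc ∑ q ∈ Finset.Icc 1 Q, ((Finset.Icc ⌈q * G - 1⌉ ⌊q * (G + R) + 1⌋).card : ℝ)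
        * (1 + E * ((q : ℝ) ^ 2)⁻¹)
      ≤ ∑ q ∈ Finset.Icc 1 Q, ((Q * R + 3) + E * R * (q : ℝ)⁻¹ + 3 * E * ((q : ℝ) ^ 2)⁻¹) := by
        refine Finset.sum_le_sum fun q hq => ?_
        rw [Finset.mem_Icc] at hq
        have hq0 : (0 : ℝ) < q := by exact_mod_cast hq.1
        have hqQ : (q : ℝ) ≤ Q := by exact_mod_cast hq.2
        calc _ ≤ (q * R + 3) * (1 + E * ((q : ℝ) ^ 2)⁻¹) := by
              gcongr
              exact hwidth q
          _ = (q * R + 3) + E * R * (q : ℝ)⁻¹ + 3 * E * ((q : ℝ) ^ 2)⁻¹ := by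
              field_simp
              ring
          _ ≤ _ := by gcongr
    _ = Q * (Q * R + 3) + E * R * ∑ q ∈ Finset.Icc 1 Q, (q : ℝ)⁻¹
        + 3 * E * ∑ q ∈ Finset.Icc 1 Q, ((q : ℝ) ^ 2)⁻¹ := by
        rw [Finset.sum_add_distrib, Finset.sum_add_distrib, ← Finset.mul_sum, ← Finset.mul_sum]
        simp
        ring
    _ ≤ Q * (Q * R + 3) + E * R * (1 + Real.log Q) + 3 * E * 2 := by
        gcongr
        · exact sum_Icc_inv_le_log Q
        · exact sum_Icc_inv_sq_le_two Q
    _ = _ := by ring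

/-- Vinogradov's elementary estimate for the sawtooth sum over a sequence with slowly and
monotonically varying slope. -/
lemma abs_sum_sawtooth_le_of_curvature {c₁ c₂ y R G : ℝ} {f g : ℕ → ℝ} {A B : ℕ} (hc₁ : 0 < c₁)
    (hc₂ : 0 ≤ c₂) (hy : 1 ≤ y) (hR : 0 ≤ R) (hg : ∀ m ∈ Finset.Ico A B, G ≤ g m ∧ g m ≤ G + R)
    (hmono : ∀ m n, A ≤ m → m < n → n < B → c₁ / y ^ 3 * (n - m) ≤ g m - g n)
    (hf : ∀ m j, A ≤ m → m + j < B → |f (m + j) - (f m + j * g m)| ≤ c₂ / y ^ 3 * j ^ 2) :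
    |∑ m ∈ Finset.Ico A B, sawtooth (f m)|
      ≤ ((3 + 16 * c₂) * (10 + 24 / c₁) + 2) * (y ^ 2 + R * (y ^ 2 * y ^ (1 / 4 : ℝ))) := by
  set Q := ⌈y⌉₊ with hQ
  have hQ0 : 0 < Q := Nat.ceil_pos.2 (by linarith)
  have hyQ : y ≤ Q := Nat.le_ceil y
  have hQy : (Q : ℝ) ≤ 2 * y := by
    have := Nat.ceil_lt_add_one (by linarith : 0 ≤ y)
    linarith
  have hQ1 : (1 : ℝ) ≤ Q := hy.trans hyQ
  choose r hr hrQ using fun m => Real.exists_rat_abs_sub_le_and_den_le (g m) hQ0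
  have hK : ∀ m, A ≤ m → m + (r m).den ≤ B →
      |∑ j ∈ Finset.range (r m).den, sawtooth (f (m + j))| ≤ 3 + 16 * c₂ := by
    intro m hm hmB
    set q := (r m).den with hq
    have hqpos : 0 < q := (r m).den_pos
    have hq0 : (0 : ℝ) < q := by exact_mod_cast hqpos
    have hqQ : (q : ℝ) ≤ Q := by exact_mod_cast hrQ m
    have hcop : IsCoprime (r m).num (q : ℤ) := by
      rw [Int.isCoprime_iff_gcd_eq_one]
      exact (r m).reduced
    refine (abs_sum_sawtooth_near_progression_le hqpos hcop (c := f m)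
      (ε := c₂ / y ^ 3 * q ^ 2 + 1 / (Q + 1)) ?_).trans ?_
    · intro j hj
      have hjq : (j : ℝ) ≤ q := by exact_mod_cast hj.le
      have h1 := hf m j hm (by omega)
      have h2 : |(j : ℝ) * (g m - r m)| ≤ 1 / (Q + 1) := by
        rw [abs_mul, abs_of_nonneg (by positivity)]
        calc (j : ℝ) * |g m - r m| ≤ q * (1 / ((Q + 1) * q)) := by
              gcongr
              exact hr m
          _ = 1 / (Q + 1) := by field_simp
      have h3 : f (m + j) - (f m + j * ((r m).num / q))
          = (f (m + j) - (f m + j * g m)) + j * (g m - r m) := by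
        have : (r m : ℝ) = (r m).num / q := Rat.cast_def (r m)
        rw [this]
        ring
      rw [h3]
      refine (abs_add_le _ _).trans (add_le_add (h1.trans ?_) h2)
      gcongr
    · have h1 : q * (1 / ((Q : ℝ) + 1)) ≤ 1 := by
        rw [mul_one_div, div_le_one (by positivity)]
        linarith
      have h2 : q * (c₂ / y ^ 3 * q ^ 2) ≤ 8 * c₂ := by
        have h3 : (q : ℝ) ^ 3 ≤ (2 * y) ^ 3 := by
          gcongr
          exact hqQ.trans hQy
        calc q * (c₂ / y ^ 3 * q ^ 2) = c₂ / y ^ 3 * q ^ 3 := by ring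
          _ ≤ c₂ / y ^ 3 * (2 * y) ^ 3 := by gcongr
          _ = 8 * c₂ := by field_simp; ring
      nlinarith
  obtain ⟨S, hS, hsp, hsum⟩ := exists_greedy_tiling (fun m => sawtooth (f m)) (fun m => (r m).den)
    Q (fun m => (r m).den_pos) hrQ (fun m => (abs_sawtooth_le _).trans (by norm_num)) A B hK
  have hcard := card_tiling_le (l := c₁ / y ^ 3) (by positivity) hR (fun s hs => hg s (hS hs))
    (fun s _ => hr s) (fun s _ => hrQ s) hsp (fun s hs t ht hst =>
      hmono s t (Finset.mem_Ico.1 (hS hs)).1 hst (Finset.mem_Ico.1 (hS ht)).2)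
  refine hsum.trans ?_
  set w := y ^ (1 / 4 : ℝ) with hw
  have hw1 : 1 ≤ w := Real.one_le_rpow hy (by norm_num)
  have hlog : 1 + Real.log Q ≤ 6 * w := by
    have h1 : Real.log Q ≤ Real.log (2 * y) := Real.log_le_log (by positivity) hQy
    rw [Real.log_mul (by norm_num) (by linarith)] at h1
    have h2 := Real.log_le_rpow_div (by linarith : 0 ≤ y) (by norm_num : (0 : ℝ) < 1 / 4)
    have h3 := Real.log_two_lt_d9
    rw [← hw] at h2
    linarith
  have hE : 2 / ((Q + 1) * (c₁ / y ^ 3)) ≤ 2 / c₁ * y ^ 2 := by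
    calc 2 / ((Q + 1) * (c₁ / y ^ 3)) ≤ 2 / (y * (c₁ / y ^ 3)) := by
          gcongr
          linarith
      _ = _ := by field_simp
  have hcard2 : (S.card : ℝ) ≤ (10 + 24 / c₁) * (y ^ 2 + R * (y ^ 2 * w)) := by
    have hyy : y ≤ y ^ 2 := by nlinarith
    have hyw : R * y ^ 2 ≤ R * (y ^ 2 * w) := by
      gcongr
      exact le_mul_of_one_le_right (by positivity) hw1
    calc (S.card : ℝ) ≤ R * Q ^ 2 + 3 * Q
          + 2 / ((Q + 1) * (c₁ / y ^ 3)) * (R * (1 + Real.log Q) + 6) := hcard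
      _ ≤ R * (2 * y) ^ 2 + 3 * (2 * y) + 2 / c₁ * y ^ 2 * (R * (6 * w) + 6) := by
          have : 0 ≤ Real.log Q := Real.log_nonneg hQ1
          gcongr
      _ = 4 * (R * y ^ 2) + 6 * y + 12 / c₁ * (y ^ 2 + R * (y ^ 2 * w)) := by ring
      _ ≤ 4 * (R * (y ^ 2 * w)) + 6 * y ^ 2 + 12 / c₁ * (y ^ 2 + R * (y ^ 2 * w)) := by gcongr
      _ ≤ _ := by
          have h1 : 0 ≤ R * (y ^ 2 * w) := by positivity
          have h2 : 0 ≤ 12 / c₁ * (y ^ 2 + R * (y ^ 2 * w)) := by positivity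
          have h3 : 24 / c₁ = 2 * (12 / c₁) := by ring
          rw [h3]
          nlinarith
  have hQ2 : (Q : ℝ) ≤ 2 * (y ^ 2 + R * (y ^ 2 * w)) := by
    have h1 : 0 ≤ R * (y ^ 2 * w) := by positivity
    nlinarith
  calc (3 + 16 * c₂) * S.card + Q
      ≤ (3 + 16 * c₂) * ((10 + 24 / c₁) * (y ^ 2 + R * (y ^ 2 * w)))
        + 2 * (y ^ 2 + R * (y ^ 2 * w)) := by gcongr
    _ = _ := by ring

/-- The arc `u ↦ (1 - u^k)^(1/k)` of the Lamé curve in the first quadrant. -/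
noncomputable def lameArc (k : ℕ) (u : ℝ) : ℝ := (1 - u ^ k) ^ (1 / k : ℝ)

/-- The derivative of `lameArc`. -/
noncomputable def lameSlope (k : ℕ) (u : ℝ) : ℝ := -(u ^ (k - 1) * (1 - u ^ k) ^ (1 / k - 1 : ℝ))

/-- The common value of the coordinates of the point of the Lamé curve on the diagonal. -/
noncomputable def lameDiag (k : ℕ) : ℝ := (1 / 2) ^ (1 / k : ℝ)

lemma lameDiag_pos (k : ℕ) : 0 < lameDiag k := Real.rpow_pos_of_pos (by norm_num) _

lemma lameDiag_pow {k : ℕ} (hk : k ≠ 0) : lameDiag k ^ k = 1 / 2 := by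
  rw [lameDiag, one_div (k : ℝ), Real.rpow_inv_natCast_pow (by norm_num) hk]

lemma lameDiag_lt_one {k : ℕ} (hk : k ≠ 0) : lameDiag k < 1 :=
  Real.rpow_lt_one (by norm_num) (by norm_num) (by positivity)

lemma lameArc_lameDiag {k : ℕ} (hk : k ≠ 0) : lameArc k (lameDiag k) = lameDiag k := by
  rw [lameArc, lameDiag_pow hk, lameDiag]
  norm_num

lemma lameArc_zero {k : ℕ} (hk : k ≠ 0) : lameArc k 0 = 1 := by simp [lameArc, hk]

lemma continuous_lameArc (k : ℕ) : Continuous (lameArc k) :=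
  Continuous.rpow_const (by fun_prop) fun _ => Or.inr (by positivity)

lemma lameArc_pow {k : ℕ} (hk : k ≠ 0) {u : ℝ} (hu : u ^ k ≤ 1) :
    lameArc k u ^ k = 1 - u ^ k := by
  rw [lameArc, one_div (k : ℝ), Real.rpow_inv_natCast_pow (by linarith) hk]

lemma lameArc_nonneg {k : ℕ} {u : ℝ} (hu : u ^ k ≤ 1) : 0 ≤ lameArc k u :=
  Real.rpow_nonneg (by linarith) _

lemma lameArc_le_one {k : ℕ} {u : ℝ} (hu0 : 0 ≤ u) (hu : u ^ k ≤ 1) : lameArc k u ≤ 1 :=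
  Real.rpow_le_one (by linarith) (by linarith [pow_nonneg hu0 k]) (by positivity)

lemma lameArc_lameArc {k : ℕ} (hk : k ≠ 0) {u : ℝ} (hu0 : 0 ≤ u) (hu : u ^ k ≤ 1) :
    lameArc k (lameArc k u) = u := by
  rw [lameArc, lameArc_pow hk hu, sub_sub_cancel, one_div, Real.pow_rpow_inv_natCast hu0 hk]

lemma hasDerivAt_lameArc {k : ℕ} (hk : k ≠ 0) {u : ℝ} (hu : u ^ k < 1) :
    HasDerivAt (lameArc k) (lameSlope k u) u := by
  have h := ((hasDerivAt_pow k u).const_sub 1).rpow_const (p := (1 / k : ℝ))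
    (Or.inl (by linarith : 1 - u ^ k ≠ 0))
  have hk0 : (k : ℝ) ≠ 0 := by exact_mod_cast hk
  refine h.congr_deriv ?_
  rw [lameSlope]
  field_simp

lemma hasDerivAt_lameSlope {k : ℕ} (hk : 2 ≤ k) {u : ℝ} (hu : u ^ k < 1) :
    HasDerivAt (lameSlope k) (-((k - 1) * u ^ (k - 2) * (1 - u ^ k) ^ (1 / k - 2 : ℝ))) u := by
  have hpos : 0 < 1 - u ^ k := by linarith
  have h := ((hasDerivAt_pow (k - 1) u).fun_mul
    (((hasDerivAt_pow k u).const_sub 1).rpow_const (p := (1 / k - 1 : ℝ)) (Or.inl hpos.ne'))).neg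
  have hk0 : (k : ℝ) ≠ 0 := by
    have : k ≠ 0 := by omega
    exact_mod_cast this
  refine h.congr_deriv ?_
  obtain ⟨n, rfl⟩ := Nat.exists_eq_add_of_le hk
  rw [show (1 / ((2 + n : ℕ) : ℝ) - 1) = (1 / ((2 + n : ℕ) : ℝ) - 2) + 1 by ring,
    Real.rpow_add_one hpos.ne', add_sub_cancel_right]
  rw [show 2 + n - 1 - 1 = n by omega, show 2 + n - 1 = n + 1 by omega,
    show 2 + n - 2 = n by omega]
  push_cast at hk0 ⊢
  field_simp
  ring

lemma pow_le_half_of_le_lameDiag {k : ℕ} (hk : k ≠ 0) {u : ℝ} (hu0 : 0 ≤ u)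
    (hu : u ≤ lameDiag k) : u ^ k ≤ 1 / 2 :=
  (pow_le_pow_left₀ hu0 hu k).trans_eq (lameDiag_pow hk)

lemma rpow_mem_Icc_one_four {w p : ℝ} (hw : 1 / 2 ≤ w) (hw1 : w ≤ 1) (hp : -2 ≤ p)
    (hp0 : p ≤ 0) : 1 ≤ w ^ p ∧ w ^ p ≤ 4 := by
  have hw0 : 0 < w := by linarith
  refine ⟨Real.one_le_rpow_of_pos_of_le_one_of_nonpos hw0 hw1 hp0, ?_⟩
  calc w ^ p ≤ (1 / 2 : ℝ) ^ p := Real.rpow_le_rpow_of_nonpos (by norm_num) hw hp0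
    _ ≤ (1 / 2 : ℝ) ^ (-2 : ℝ) :=
        Real.rpow_le_rpow_of_exponent_ge (by norm_num) (by norm_num) hp
    _ = 4 := by
        rw [Real.rpow_neg (by norm_num), show (2 : ℝ) = ((2 : ℕ) : ℝ) by norm_num,
          Real.rpow_natCast]
        norm_num

lemma lameSlope_mem_Icc {k : ℕ} (hk : k ≠ 0) {u : ℝ} (hu0 : 0 ≤ u) (hu : u ≤ lameDiag k) :
    -(4 * u ^ (k - 1)) ≤ lameSlope k u ∧ lameSlope k u ≤ 0 := by
  have h1 := pow_le_half_of_le_lameDiag hk hu0 hu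
  have h2 := pow_nonneg hu0 k
  have hk1 : (1 : ℝ) / k ≤ 1 := by
    rw [div_le_one (by positivity)]
    exact_mod_cast Nat.one_le_iff_ne_zero.2 hk
  have hk2 : (0 : ℝ) ≤ 1 / k := by positivity
  have h3 := rpow_mem_Icc_one_four (w := 1 - u ^ k) (p := 1 / k - 1) (by linarith) (by linarith)
    (by linarith) (by linarith)
  have h4 := pow_nonneg hu0 (k - 1)
  rw [lameSlope]
  constructor <;> nlinarith

/-- The slope of the Lamé arc decreases at a rate comparable with `u ^ (k - 2)`. -/
lemma lameSlope_sub_mem_Icc {k : ℕ} (hk : 2 ≤ k) {a s t b : ℝ} (ha : 0 ≤ a) (has : a ≤ s)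
    (hst : s < t) (htb : t ≤ b) (hb : b ≤ lameDiag k) :
    (k - 1) * a ^ (k - 2) * (t - s) ≤ lameSlope k s - lameSlope k t ∧
      lameSlope k s - lameSlope k t ≤ 4 * (k - 1) * b ^ (k - 2) * (t - s) := by
  have hk0 : k ≠ 0 := by omega
  have hpow : ∀ v, s ≤ v → v ≤ t → v ^ k ≤ 1 / 2 := fun v h1 h2 =>
    pow_le_half_of_le_lameDiag hk0 (ha.trans (has.trans h1)) (h2.trans (htb.trans hb))
  have hder : ∀ v, s ≤ v → v ≤ t → HasDerivAt (lameSlope k) _ v := fun v h1 h2 =>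
    hasDerivAt_lameSlope hk (by linarith [hpow v h1 h2])
  obtain ⟨c, hc, hcs⟩ := exists_hasDerivAt_eq_slope (lameSlope k) _ hst
    (fun v hv => (hder v hv.1 hv.2).continuousAt.continuousWithinAt)
    (fun v hv => hder v hv.1.le hv.2.le)
  have hts : 0 < t - s := sub_pos.2 hst
  rw [eq_div_iff hts.ne'] at hcs
  have hc0 : 0 ≤ c := ha.trans (has.trans hc.1.le)
  have hk1 : (2 : ℝ) ≤ k := by exact_mod_cast hk
  have hk2 : (1 : ℝ) / k ≤ 1 := by
    rw [div_le_one (by positivity)]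
    linarith
  have hk3 : (0 : ℝ) ≤ 1 / k := by positivity
  obtain ⟨h1, h4⟩ := rpow_mem_Icc_one_four (w := 1 - c ^ k) (p := 1 / k - 2)
    (by linarith [hpow c hc.1.le hc.2.le]) (by linarith [pow_nonneg hc0 k])
    (by linarith) (by linarith)
  have hca : a ^ (k - 2) ≤ c ^ (k - 2) := pow_le_pow_left₀ ha (has.trans hc.1.le) _
  have hcb : c ^ (k - 2) ≤ b ^ (k - 2) := pow_le_pow_left₀ hc0 (hc.2.le.trans htb) _
  have hk4 : (0 : ℝ) ≤ k - 1 := by linarith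
  have key : lameSlope k s - lameSlope k t
      = (k - 1) * c ^ (k - 2) * (1 - c ^ k) ^ (1 / k - 2 : ℝ) * (t - s) := by linarith
  rw [key]
  have ha' := pow_nonneg ha (k - 2)
  have hc' := pow_nonneg hc0 (k - 2)
  have hb' := hc'.trans hcb
  constructor
  · refine mul_le_mul_of_nonneg_right ?_ hts.le
    calc (k - 1) * a ^ (k - 2) ≤ (k - 1) * c ^ (k - 2) := by gcongr
      _ ≤ _ := le_mul_of_one_le_right (by positivity) h1
  · refine mul_le_mul_of_nonneg_right ?_ hts.le
    calc (k - 1) * c ^ (k - 2) * (1 - c ^ k) ^ (1 / k - 2 : ℝ)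
        ≤ (k - 1) * b ^ (k - 2) * 4 := by gcongr
      _ = _ := by ring

lemma abs_lameArc_sub_taylor_le {k : ℕ} (hk : 2 ≤ k) {s t b : ℝ} (hs : 0 ≤ s) (hst : s ≤ t)
    (htb : t ≤ b) (hb : b ≤ lameDiag k) :
    |lameArc k t - (lameArc k s + (t - s) * lameSlope k s)|
      ≤ 4 * (k - 1) * b ^ (k - 2) * (t - s) ^ 2 := by
  have hk0 : k ≠ 0 := by omega
  rcases hst.eq_or_lt with rfl | hst
  · simp
  have hder : ∀ v, s ≤ v → v ≤ t → HasDerivAt (lameArc k) (lameSlope k v) v := fun v h1 h2 =>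
    hasDerivAt_lameArc hk0 (by
      linarith [pow_le_half_of_le_lameDiag hk0 (hs.trans h1) (h2.trans (htb.trans hb))])
  obtain ⟨c, hc, hcs⟩ := exists_hasDerivAt_eq_slope (lameArc k) (lameSlope k) hst
    (fun v hv => (hder v hv.1 hv.2).continuousAt.continuousWithinAt)
    (fun v hv => hder v hv.1.le hv.2.le)
  have hts : 0 < t - s := sub_pos.2 hst
  rw [eq_div_iff hts.ne'] at hcs
  obtain ⟨h1, h2⟩ := lameSlope_sub_mem_Icc hk hs le_rfl hc.1 (hc.2.le.trans htb) hb
  have hk1 : (2 : ℝ) ≤ k := by exact_mod_cast hk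
  have hk4 : (0 : ℝ) ≤ k - 1 := by linarith
  have h0 : 0 ≤ lameSlope k s - lameSlope k c := by
    have := sub_pos.2 hc.1
    exact le_trans (by positivity) h1
  have h3 : lameArc k t - (lameArc k s + (t - s) * lameSlope k s)
      = -((lameSlope k s - lameSlope k c) * (t - s)) := by linarith
  have hb0 : 0 ≤ b := hs.trans (hst.le.trans htb)
  rw [h3, abs_neg, abs_of_nonneg (by positivity)]
  calc (lameSlope k s - lameSlope k c) * (t - s)
      ≤ 4 * (k - 1) * b ^ (k - 2) * (c - s) * (t - s) := by gcongr
    _ ≤ 4 * (k - 1) * b ^ (k - 2) * (t - s) * (t - s) := by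
        gcongr
        exact hc.2.le
    _ = _ := by ring

/-- The sawtooth sum over a dyadic piece of the dilated Lamé arc. -/
lemma abs_sum_sawtooth_lameArc_dyadic_le {k : ℕ} (hk : 2 ≤ k) {x t y : ℝ} (hx : 0 < x)
    (ht : 0 < t) (htx : t ≤ x * lameDiag k) (hy : 1 ≤ y) (hyx : y ^ 3 = x / (t / x) ^ (k - 2)) :
    |∑ m ∈ Finset.Ioc ⌊t / 2⌋₊ ⌊t⌋₊, sawtooth (x * lameArc k (m / x))|
      ≤ ((3 + 16 * (4 * (k - 1))) * (10 + 24 / ((k - 1) / 2 ^ (k - 2))) + 2)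
        * (y ^ 2 + 4 * (t / x) ^ (k - 1) * (y ^ 2 * y ^ (1 / 4 : ℝ))) := by
  have hk0 : k ≠ 0 := by omega
  have hk1 : (2 : ℝ) ≤ k := by exact_mod_cast hk
  have hk4 : (0 : ℝ) < k - 1 := by linarith
  have hIoc : Finset.Ioc ⌊t / 2⌋₊ ⌊t⌋₊ = Finset.Ico (⌊t / 2⌋₊ + 1) (⌊t⌋₊ + 1) := by
    ext
    simp only [Finset.mem_Ioc, Finset.mem_Ico]
    omega
  have hub : t / x ≤ lameDiag k := by rwa [div_le_iff₀' hx]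
  have hlow : ∀ m : ℕ, ⌊t / 2⌋₊ + 1 ≤ m → t / x / 2 ≤ m / x := by
    intro m hm
    have := (Nat.floor_lt (by positivity : 0 ≤ t / 2)).1 hm
    rw [div_right_comm]
    gcongr
  have hupp : ∀ m : ℕ, m < ⌊t⌋₊ + 1 → m / x ≤ t / x := by
    intro m hm
    have := (Nat.le_floor_iff ht.le).1 (Nat.lt_succ_iff.1 hm)
    gcongr
  rw [hIoc]
  refine abs_sum_sawtooth_le_of_curvature (g := fun m => lameSlope k (m / x))
    (G := -(4 * (t / x) ^ (k - 1))) (by positivity) (by positivity) hy (by positivity) ?_ ?_ ?_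
  · intro m hm
    rw [Finset.mem_Ico] at hm
    have h1 := hupp m hm.2
    have h0 : 0 ≤ m / x := by positivity
    obtain ⟨h2, h3⟩ := lameSlope_mem_Icc hk0 h0 (h1.trans hub)
    have h4 : (m / x) ^ (k - 1) ≤ (t / x) ^ (k - 1) := pow_le_pow_left₀ h0 h1 _
    constructor <;> linarith
  · intro m n hm hmn hn
    have hmn' : m / x < n / x := by gcongr
    have h := (lameSlope_sub_mem_Icc hk (by positivity) (hlow m hm) hmn' (hupp n hn) hub).1
    refine le_trans (le_of_eq ?_) h
    rw [hyx, div_pow (t / x) 2]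
    field_simp
  · intro m j hm hmj
    have hj : m / x ≤ (m + j : ℕ) / x := by gcongr; omega
    have h := abs_lameArc_sub_taylor_le hk (by positivity) hj (hupp _ hmj) hub
    have h1 : x * lameArc k ((m + j : ℕ) / x) - (x * lameArc k (m / x) + j * lameSlope k (m / x))
        = x * (lameArc k ((m + j : ℕ) / x) - (lameArc k (m / x)
          + ((m + j : ℕ) / x - m / x) * lameSlope k (m / x))) := by
      push_cast
      field_simp
      ring
    rw [h1, abs_mul, abs_of_pos hx]
    refine (mul_le_mul_of_nonneg_left h hx.le).trans (le_of_eq ?_)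
    rw [hyx]
    push_cast
    field_simp
    ring

lemma cauer_dyadic_exponents {k : ℕ} (hk : 3 ≤ k) {x t X : ℝ} (hx : 1 ≤ x)
    (hX : X = x ^ (1 - 1 / (2 * (k : ℝ) - 1))) (hXt : X ≤ t) (htx : t ≤ x) :
    ∃ y : ℝ, 1 ≤ y ∧ y ^ 3 = x / (t / x) ^ (k - 2) ∧ y ^ 2 ≤ X * √(X / t) ∧
      (t / x) ^ (k - 1) * (y ^ 2 * y ^ (1 / 4 : ℝ)) ≤ X * (t / x) := by
  have hx0 : 0 < x := by linarith
  have hX0 : 0 < X := hX ▸ Real.rpow_pos_of_pos hx0 _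
  have ht0 : 0 < t := hX0.trans_le hXt
  have hk3 : (3 : ℝ) ≤ k := by exact_mod_cast hk
  obtain ⟨d, hd⟩ : ∃ d, d = Real.log x / (2 * k - 1) := ⟨_, rfl⟩
  obtain ⟨l, hl⟩ : ∃ l, l = Real.log (t / x) := ⟨_, rfl⟩
  have hd0 : 0 ≤ d := hd ▸ div_nonneg (Real.log_nonneg hx) (by linarith)
  have hl0 : l ≤ 0 := hl ▸ Real.log_nonpos (by positivity) ((div_le_one hx0).2 htx)
  have hk1 : (2 * (k : ℝ) - 1) ≠ 0 := by linarith
  have hxe : x = exp ((2 * k - 1) * d) := by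
    rw [hd, mul_div_cancel₀ _ hk1, Real.exp_log hx0]
  have hte : t / x = exp l := by rw [hl, Real.exp_log (by positivity)]
  have hXe : X = exp ((2 * k - 2) * d) := by
    rw [hX, hxe, ← Real.exp_mul]
    congr 1
    field_simp
    ring
  have ht : t = exp ((2 * k - 1) * d + l) := by
    rw [Real.exp_add, ← hxe, ← hte]
    field_simp
  have hdl : 0 ≤ d + l := by
    have := hXt
    rw [hXe, ht, Real.exp_le_exp] at this
    linarith
  have hc2 : ((k - 2 : ℕ) : ℝ) = k - 2 := by
    rw [Nat.cast_sub (by omega)]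
    norm_num
  have hc1 : ((k - 1 : ℕ) : ℝ) = k - 1 := by
    rw [Nat.cast_sub (by omega)]
    norm_num
  have hXt2 : √(X / t) = exp ((-d - l) / 2) := by
    rw [hXe, ht, ← Real.exp_sub, Real.sqrt_eq_rpow, ← Real.exp_mul]
    congr 1
    ring
  refine ⟨exp (((2 * k - 1) * d - (k - 2) * l) / 3), ?_, ?_, ?_, ?_⟩
  · rw [Real.one_le_exp_iff]
    have h1 : 0 ≤ (2 * (k : ℝ) - 1) * d := mul_nonneg (by linarith) hd0
    have h2 : 0 ≤ ((k : ℝ) - 2) * (-l) := mul_nonneg (by linarith) (by linarith)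
    linarith
  · rw [hte, hxe, ← Real.exp_nat_mul, ← Real.exp_nat_mul, ← Real.exp_sub, hc2]
    congr 1
    push_cast
    ring
  · rw [hXt2, hXe, ← Real.exp_nat_mul, ← Real.exp_add, Real.exp_le_exp]
    push_cast
    nlinarith [mul_nonneg (by linarith : (0 : ℝ) ≤ k - 3) hdl]
  · rw [hte, hXe, ← Real.exp_nat_mul, ← Real.exp_nat_mul, ← Real.exp_mul, ← Real.exp_add,
      ← Real.exp_add, ← Real.exp_add, Real.exp_le_exp, hc1]
    push_cast
    nlinarith [mul_nonneg (by linarith : (0 : ℝ) ≤ k - 3) hd0,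
      mul_nonneg (by linarith : (0 : ℝ) ≤ k - 3) (by linarith : 0 ≤ -l)]

/-- Cauer's bound for the sawtooth sum over the dilated Lamé arc up to the diagonal. -/
lemma exists_abs_sum_sawtooth_lameArc_le {k : ℕ} (hk : 3 ≤ k) :
    ∃ C : ℝ, ∀ x : ℝ, 1 ≤ x →
      |∑ m ∈ Finset.Ioc 0 ⌊x * lameDiag k⌋₊, sawtooth (x * lameArc k (m / x))|
        ≤ C * x ^ (1 - 1 / (2 * (k : ℝ) - 1)) := by
  have hk3 : (3 : ℝ) ≤ k := by exact_mod_cast hk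
  have hk4 : (0 : ℝ) < k - 1 := by linarith
  set C₀ : ℝ := (3 + 16 * (4 * (k - 1))) * (10 + 24 / ((k - 1) / 2 ^ (k - 2))) + 2 with hC₀
  have hC₀0 : 0 ≤ C₀ := by positivity
  set C : ℝ := 4 * C₀ with hC
  have hC0 : 0 ≤ C := by positivity
  refine ⟨1 + C * 7, fun x hx => ?_⟩
  set X := x ^ (1 - 1 / (2 * (k : ℝ) - 1)) with hX
  have hx0 : 0 < x := by linarith
  have hX0 : 0 < X := Real.rpow_pos_of_pos hx0 _
  have hdiag := lameDiag_lt_one (k := k) (by omega)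
  set S : ℝ → ℝ := fun t => ∑ m ∈ Finset.Ioc 0 ⌊t⌋₊, sawtooth (x * lameArc k (m / x)) with hS
  have htriv : ∀ t, 0 ≤ t → |S t| ≤ t := by
    intro t ht
    refine (abs_sum_sawtooth_le _ _).trans ?_
    rw [Nat.card_Ioc, Nat.sub_zero]
    linarith [Nat.floor_le ht]
  have hdyadic : ∀ n : ℕ, ∀ t, X / 2 ≤ t → t ≤ x * lameDiag k → t ≤ X * 2 ^ n →
      |S t| ≤ X * (1 + C * (5 - 3 * √(X / t) + 2 * (t / x))) := by
    have hbase : ∀ t, X / 2 ≤ t → t ≤ X →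
        |S t| ≤ X * (1 + C * (5 - 3 * √(X / t) + 2 * (t / x))) := by
      intro t htl htu
      have ht0 : 0 < t := by linarith
      have h1 : √(X / t) ≤ 5 / 3 := by
        rw [Real.sqrt_le_left (by norm_num), div_le_iff₀ ht0]
        linarith
      have h2 : 0 ≤ C * (5 - 3 * √(X / t) + 2 * (t / x)) := by
        have : 0 ≤ t / x := by positivity
        exact mul_nonneg hC0 (by linarith)
      calc |S t| ≤ t := htriv t ht0.le
        _ ≤ X * 1 := by linarith
        _ ≤ _ := by gcongr; linarith
    intro n
    induction n with
    | zero =>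
      intro t htl _ htn
      exact hbase t htl (by simpa using htn)
    | succ n ih =>
      intro t htl htx htn
      rcases le_total t X with htX | hXt
      · exact hbase t htl htX
      have ht0 : 0 < t := by linarith
      have hih := ih (t / 2) (by linarith) (by linarith) (by rw [pow_succ] at htn; linarith)
      obtain ⟨y, hy1, hy3, hy2, hyR⟩ := cauer_dyadic_exponents hk hx hX hXt
        (htx.trans (mul_le_of_le_one_right hx0.le hdiag.le))
      have hblock := abs_sum_sawtooth_lameArc_dyadic_le (by omega) hx0 ht0 htx hy1 hy3
      rw [← hC₀] at hblock
      have hsplit : S t = S (t / 2)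
          + ∑ m ∈ Finset.Ioc ⌊t / 2⌋₊ ⌊t⌋₊, sawtooth (x * lameArc k (m / x)) := by
        rw [hS]
        exact (Finset.sum_Ioc_consecutive _ (Nat.zero_le _)
          (Nat.floor_le_floor (by linarith))).symm
      have hroot : 4 / 3 * √(X / t) ≤ √(X / (t / 2)) := by
        rw [Real.le_sqrt (by positivity) (by positivity), mul_pow, Real.sq_sqrt (by positivity)]
        have : X / (t / 2) = 2 * (X / t) := by field_simp
        rw [this]
        have : 0 ≤ X / t := by positivity
        linarith
      have hstep : C₀ * (y ^ 2 + 4 * (t / x) ^ (k - 1) * (y ^ 2 * y ^ (1 / 4 : ℝ)))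
          ≤ X * (C * (√(X / t) + t / x)) := by
        calc _ = C₀ * (y ^ 2 + 4 * ((t / x) ^ (k - 1) * (y ^ 2 * y ^ (1 / 4 : ℝ)))) := by ring
          _ ≤ C₀ * (4 * (X * √(X / t)) + 4 * (X * (t / x))) := by
              gcongr
              nlinarith
          _ = _ := by rw [hC]; ring
      rw [hsplit]
      refine (abs_add_le _ _).trans ((add_le_add hih (hblock.trans hstep)).trans ?_)
      rw [← mul_add, add_assoc, ← mul_add]
      have h2 : t / 2 / x = t / x / 2 := by ring
      rw [h2]
      refine mul_le_mul_of_nonneg_left ?_ hX0.le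
      have := mul_le_mul_of_nonneg_left hroot hC0
      linarith
  rcases le_total (x * lameDiag k) X with h | h
  · refine (htriv _ (mul_nonneg hx0.le (lameDiag_pos k).le)).trans ?_
    nlinarith
  · obtain ⟨n, hn⟩ := pow_unbounded_of_one_lt (x * lameDiag k / X) (by norm_num : (1 : ℝ) < 2)
    rw [div_lt_iff₀' hX0] at hn
    refine (hdyadic n _ (by linarith) le_rfl hn.le).trans ?_
    rw [mul_comm, mul_div_cancel_left₀ _ hx0.ne']
    gcongr
    linarith [Real.sqrt_nonneg (X / (x * lameDiag k))]

lemma integral_lameArc_split {k : ℕ} (hk : k ≠ 0) :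
    ∫ u in (0 : ℝ)..1, lameArc k u
      = 2 * (∫ u in (0 : ℝ)..lameDiag k, lameArc k u) - lameDiag k ^ 2 := by
  have hc := continuous_lameArc k
  have hF : ∀ v, HasDerivAt (fun v => ∫ u in (0 : ℝ)..v, lameArc k u) (lameArc k v) v := fun v =>
    intervalIntegral.integral_hasDerivAt_right (hc.intervalIntegrable _ _)
      hc.aestronglyMeasurable.stronglyMeasurableAtFilter hc.continuousAt
  set H : ℝ → ℝ := fun v => (∫ u in (0 : ℝ)..v, lameArc k u)
    + (∫ u in (0 : ℝ)..lameArc k v, lameArc k u) - v * lameArc k v with hH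
  have hder : ∀ v ∈ Set.Icc 0 (lameDiag k), HasDerivAt H 0 v := by
    intro v hv
    have hv1 : v ^ k < 1 := by linarith [pow_le_half_of_le_lameDiag hk hv.1 hv.2]
    have h1 := hasDerivAt_lameArc hk hv1
    have h2 := ((hF v).fun_add ((hF (lameArc k v)).comp v h1)).fun_sub
      ((hasDerivAt_id v).fun_mul h1)
    refine h2.congr_deriv ?_
    rw [lameArc_lameArc hk hv.1 hv1.le]
    simp only [id]
    ring
  have hconst := constant_of_has_deriv_right_zero
    (fun v hv => (hder v hv).continuousAt.continuousWithinAt)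
    (fun v hv => (hder v (Set.Ico_subset_Icc_self hv)).hasDerivWithinAt)
    (lameDiag k) (Set.right_mem_Icc.2 (lameDiag_pos k).le)
  simp only [hH, lameArc_lameDiag hk, lameArc_zero hk, intervalIntegral.integral_same] at hconst
  linarith

/-- The area of the Lamé domain. -/
lemma lame_area_eq {k : ℕ} (hk : k ≠ 0) :
    2 / k * (Real.Gamma (1 / k) ^ 2 / Real.Gamma (2 / k))
      = 4 * ∫ u in (0 : ℝ)..1, lameArc k u := by
  have hk0 : (0 : ℝ) < k := by positivity
  have hk1 : (1 : ℝ) ≤ k := by exact_mod_cast Nat.one_le_iff_ne_zero.2 hk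
  have hc := continuous_lameArc k
  have hca : Continuous fun t : ℝ => lameArc k |t| := hc.comp continuous_abs
  have hset : {p : Fin 2 → ℝ | ∑ i, |p i| ^ (k : ℝ) < 1} = MeasurableEquiv.finTwoArrow ⁻¹'
      regionBetween (fun t : ℝ => -lameArc k |t|) (fun t => lameArc k |t|) (Set.Ioo (-1) 1) := by
    ext p
    simp only [Set.mem_ofPred_eq, Fin.sum_univ_two, Real.rpow_natCast, Set.mem_preimage,
      regionBetween, MeasurableEquiv.finTwoArrow, Set.mem_Ioo, ← abs_lt]
    change _ ↔ |p 0| < 1 ∧ |p 1| < lameArc k |p 0|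
    constructor
    · intro h
      have h1 : |p 0| ^ k < 1 := by
        have := pow_nonneg (abs_nonneg (p 1)) k
        linarith
      refine ⟨(pow_lt_one_iff_of_nonneg (abs_nonneg _) hk).1 h1, ?_⟩
      rw [← pow_lt_pow_iff_left₀ (abs_nonneg _) (lameArc_nonneg h1.le) hk, lameArc_pow hk h1.le]
      linarith
    · rintro ⟨h1, h2⟩
      have h1' : |p 0| ^ k < 1 := (pow_lt_one_iff_of_nonneg (abs_nonneg _) hk).2 h1
      rw [← pow_lt_pow_iff_left₀ (abs_nonneg _) (lameArc_nonneg h1'.le) hk,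
        lameArc_pow hk h1'.le] at h2
      linarith
  have hpos : ∀ t ∈ Set.Ioo (-1 : ℝ) 1, 0 ≤ lameArc k |t| := fun t ht =>
    lameArc_nonneg (pow_le_one₀ (abs_nonneg _) (abs_lt.2 ht).le)
  have hint : MeasureTheory.IntegrableOn (fun t : ℝ => lameArc k |t|) (Set.Ioo (-1) 1) :=
    (hca.integrableOn_Icc (a := -1) (b := 1)).mono_set Set.Ioo_subset_Icc_self
  have hneg : MeasureTheory.IntegrableOn (fun t : ℝ => -lameArc k |t|) (Set.Ioo (-1) 1) := hint.neg
  have hmeas : MeasureTheory.NullMeasurableSet (regionBetween (fun t : ℝ => -lameArc k |t|)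
      (fun t => lameArc k |t|) (Set.Ioo (-1) 1)) MeasureTheory.volume :=
    (measurableSet_regionBetween hca.neg.measurable hca.measurable
      measurableSet_Ioo).nullMeasurableSet
  have hvol := MeasureTheory.volume_sum_rpow_lt_one (Fin 2) hk1
  rw [hset, (MeasureTheory.volume_preserving_finTwoArrow ℝ).measure_preimage hmeas,
    MeasureTheory.Measure.volume_eq_prod, volume_regionBetween_eq_integral hneg hint
      measurableSet_Ioo (fun t ht => by linarith [hpos t ht])] at hvol
  have hG1 : 0 < Real.Gamma (1 / k) := Real.Gamma_pos_of_pos (by positivity)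
  have hG2 : 0 < Real.Gamma (2 / k) := Real.Gamma_pos_of_pos (by positivity)
  have hI : ∫ y in Set.Ioo (-1 : ℝ) 1, ((fun t => lameArc k |t|) - fun t => -lameArc k |t|) y
      = 4 * ∫ u in (0 : ℝ)..1, lameArc k u := by
    have h1 : ∫ u in (0 : ℝ)..1, lameArc k |u| = ∫ u in (0 : ℝ)..1, lameArc k u := by
      refine intervalIntegral.integral_congr fun u hu => ?_
      rw [Set.uIcc_of_le zero_le_one] at hu
      simp only [abs_of_nonneg hu.1]
    have h2 : ∫ u in (-1 : ℝ)..0, lameArc k |u| = ∫ u in (0 : ℝ)..1, lameArc k |u| := by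
      have := intervalIntegral.integral_comp_neg (a := 0) (b := 1) (fun u => lameArc k |u|)
      simp only [abs_neg, neg_zero] at this
      exact this.symm
    rw [← MeasureTheory.integral_Ioc_eq_integral_Ioo,
      ← intervalIntegral.integral_of_le (by norm_num)]
    have h3 : ∀ y : ℝ, ((fun t => lameArc k |t|) - fun t => -lameArc k |t|) y
        = 2 * lameArc k |y| := fun y => by simp only [Pi.sub_apply]; ring
    simp only [h3]
    rw [intervalIntegral.integral_const_mul, ← intervalIntegral.integral_add_adjacent_intervals
      (hca.intervalIntegrable (-1) 0) (hca.intervalIntegrable 0 1), h2, h1]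
    ring
  rw [hI] at hvol
  have hI0 : 0 ≤ 4 * ∫ u in (0 : ℝ)..1, lameArc k u := by
    have : 0 ≤ ∫ u in (0 : ℝ)..1, lameArc k u :=
      intervalIntegral.integral_nonneg zero_le_one fun u hu =>
        lameArc_nonneg (pow_le_one₀ hu.1 hu.2)
    linarith
  rw [ENNReal.ofReal_eq_ofReal_iff hI0] at hvol
  · rw [hvol, Fintype.card_fin, Nat.cast_ofNat, Real.Gamma_add_one (by positivity),
      Real.Gamma_add_one (by positivity)]
    field_simp
  · have h1 := Real.Gamma_pos_of_pos (by positivity : 0 < (1 : ℝ) / k + 1)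
    have h2 := Real.Gamma_pos_of_pos (by positivity : 0 < ((Fintype.card (Fin 2) : ℕ) : ℝ) / k + 1)
    positivity

lemma abs_lameArc_scaled_taylor_le {k : ℕ} (hk : 2 ≤ k) {x s t : ℝ} (hx : 0 < x) (hs : 0 ≤ s)
    (hst : s ≤ t) (ht1 : t ≤ s + 1) (htx : t ≤ x * lameDiag k) :
    |x * lameArc k (t / x) - (x * lameArc k (s / x) + (t - s) * lameSlope k (s / x))|
      ≤ 4 * (k - 1) / x := by
  have hk1 : (2 : ℝ) ≤ k := by exact_mod_cast hk
  have hk4 : (0 : ℝ) ≤ k - 1 := by linarith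
  have h := abs_lameArc_sub_taylor_le hk (by positivity : 0 ≤ s / x)
    (by gcongr : s / x ≤ t / x) (by rwa [div_le_iff₀' hx]) le_rfl
  have hd : lameDiag k ^ (k - 2) ≤ 1 :=
    pow_le_one₀ (lameDiag_pos k).le (lameDiag_lt_one (by omega)).le
  have h1 : x * lameArc k (t / x) - (x * lameArc k (s / x) + (t - s) * lameSlope k (s / x))
      = x * (lameArc k (t / x) - (lameArc k (s / x) + (t / x - s / x) * lameSlope k (s / x))) := by
    field_simp
  have h2 : (t - s) ^ 2 ≤ 1 := pow_le_one₀ (by linarith) (by linarith)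
  rw [h1, abs_mul, abs_of_pos hx]
  calc x * _ ≤ x * (4 * (k - 1) * 1 * (t / x - s / x) ^ 2) := by
        gcongr
        exact h.trans (by gcongr)
    _ = 4 * (k - 1) / x * (t - s) ^ 2 := by
        field_simp
    _ ≤ 4 * (k - 1) / x * 1 := by gcongr
    _ = _ := mul_one _

lemma abs_lameArc_scaled_sub_le {k : ℕ} (hk : 2 ≤ k) {x s t : ℝ} (hx : 1 ≤ x) (hs : 0 ≤ s)
    (hst : s ≤ t) (ht1 : t ≤ s + 1) (htx : t ≤ x * lameDiag k) :
    |x * lameArc k (t / x) - x * lameArc k (s / x)| ≤ 4 * k := by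
  have hx0 : 0 < x := by linarith
  have hk1 : (2 : ℝ) ≤ k := by exact_mod_cast hk
  have h := abs_lameArc_scaled_taylor_le hk hx0 hs hst ht1 htx
  have hsd : s / x ≤ lameDiag k := by
    rw [div_le_iff₀' hx0]
    linarith
  obtain ⟨h1, h2⟩ := lameSlope_mem_Icc (by omega : k ≠ 0) (by positivity) hsd
  have h3 : (s / x) ^ (k - 1) ≤ 1 :=
    pow_le_one₀ (by positivity) (hsd.trans (lameDiag_lt_one (by omega)).le)
  have h4 : 4 * ((k : ℝ) - 1) / x ≤ 4 * (k - 1) := div_le_self (by linarith) hx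
  have h5 := abs_le.1 h
  rw [abs_le]
  constructor <;> nlinarith

/-- Euler–Maclaurin summation over the dilated Lamé arc up to the diagonal. -/
lemma abs_sum_lameArc_sub_integral_le {k : ℕ} (hk : 2 ≤ k) {x : ℝ} (hx : 1 ≤ x) {M : ℕ}
    (hM : M = ⌊x * lameDiag k⌋₊) :
    |∑ m ∈ Finset.Ioc 0 M, x * lameArc k (m / x)
      - (x ^ 2 * (∫ u in (0 : ℝ)..lameDiag k, lameArc k u)
        - (x * lameDiag k - M) * (x * lameDiag k) - x / 2 + x * lameDiag k / 2)|
      ≤ (14 * k : ℝ) := by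
  have hk0 : k ≠ 0 := by omega
  have hx0 : 0 < x := by linarith
  have hk1 : (2 : ℝ) ≤ k := by exact_mod_cast hk
  have hd := lameDiag_pos k
  have hd1 := lameDiag_lt_one hk0
  set z := x * lameDiag k with hz
  have hz0 : 0 < z := by positivity
  have hzx : z ≤ x := mul_le_of_le_one_right hx0.le hd1.le
  have hMz : (M : ℝ) ≤ z := hM ▸ Nat.floor_le hz0.le
  have hzM : z ≤ M + 1 := hM ▸ (Nat.lt_floor_add_one z).le
  set f : ℝ → ℝ := fun t => x * lameArc k (t / x) with hf
  have hfc : Continuous f := ((continuous_lameArc k).comp (continuous_id.div_const x)).const_mul x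
  have hfz : f z = z := by
    rw [hf, hz]
    simp only
    rw [mul_div_cancel_left₀ _ hx0.ne', lameArc_lameDiag hk0]
  have hint : x ^ 2 * (∫ u in (0 : ℝ)..lameDiag k, lameArc k u) = ∫ t in (0 : ℝ)..z, f t := by
    rw [hf, intervalIntegral.integral_const_mul, intervalIntegral.integral_comp_div _ hx0.ne',
      zero_div, hz, mul_div_cancel_left₀ _ hx0.ne', smul_eq_mul]
    ring
  have hcell : ∀ m ∈ Finset.range M,
      |(∫ t in (m : ℝ)..(m + 1 : ℕ), f t) - (f m + f (m + 1 : ℕ)) / 2| ≤ 6 * k / x := by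
    intro m hm
    have hmM : ((m + 1 : ℕ) : ℝ) ≤ z := by
      refine le_trans ?_ hMz
      exact_mod_cast Finset.mem_range.1 hm
    push_cast at hmM ⊢
    set g := lameSlope k (m / x)
    have h1 : |(∫ t in (m : ℝ)..(m + 1), (f t - (f m + (t - m) * g)))|
        ≤ 4 * (k - 1) / x * |(m + 1 : ℝ) - m| := by
      refine (Real.norm_eq_abs _).symm.trans_le
        (intervalIntegral.norm_integral_le_of_norm_le_const fun t ht => ?_)
      rw [Set.uIoc_of_le (by linarith)] at ht
      exact abs_lameArc_scaled_taylor_le hk hx0 (by positivity) ht.1.le ht.2 (by linarith [ht.2])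
    have h2 := abs_lameArc_scaled_taylor_le hk hx0 (s := m) (t := m + 1) (by positivity)
      (by linarith) le_rfl hmM
    have haux : ∀ c : ℝ, ∫ t in (m : ℝ)..(m + 1), (c + (t - m) * g) = c + g / 2 := by
      intro c
      rw [intervalIntegral.integral_add (by simp)
        (Continuous.intervalIntegrable (by fun_prop) _ _),
        intervalIntegral.integral_mul_const, intervalIntegral.integral_sub (by simp) (by simp)]
      simp
      ring
    have h3 : (∫ t in (m : ℝ)..(m + 1), (f t - (f m + (t - m) * g)))
        = (∫ t in (m : ℝ)..(m + 1), f t) - (f m + g / 2) := by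
      rw [intervalIntegral.integral_sub (hfc.intervalIntegrable _ _)
        (Continuous.intervalIntegrable (by fun_prop) _ _), haux]
    rw [h3, add_sub_cancel_left, abs_one, mul_one] at h1
    have h5 : 4 * ((k : ℝ) - 1) / x ≤ 4 * k / x := by gcongr; linarith
    have h6 : 6 * (k : ℝ) / x = 4 * k / x + 4 * k / x / 2 := by ring
    have h1' := abs_le.1 h1
    have h2' := abs_le.1 h2
    rw [h6, abs_le]
    simp only [hf] at *
    constructor <;> linarith
  have hsum : |(∫ t in (0 : ℝ)..M, f t)
      - ∑ m ∈ Finset.range M, (f m + f (m + 1 : ℕ)) / 2| ≤ 6 * k := by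
    have h1 := intervalIntegral.sum_integral_adjacent_intervals (f := f)
      (μ := MeasureTheory.volume) (a := fun n : ℕ => (n : ℝ)) (n := M)
      fun _ _ => hfc.intervalIntegrable _ _
    rw [Nat.cast_zero] at h1
    rw [← h1, ← Finset.sum_sub_distrib]
    refine (Finset.abs_sum_le_sum_abs _ _).trans ((Finset.sum_le_card_nsmul _ _ _ hcell).trans ?_)
    rw [Finset.card_range, nsmul_eq_mul]
    calc (M : ℝ) * (6 * k / x) ≤ x * (6 * k / x) := by
          gcongr
          linarith
      _ = 6 * k := by field_simp
  have htrap : ∀ n : ℕ, ∑ m ∈ Finset.range n, (f m + f (m + 1 : ℕ)) / 2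
      = ∑ m ∈ Finset.Ioc 0 n, f m + (f 0 - f n) / 2 := by
    intro n
    induction n with
    | zero => simp
    | succ n ih =>
      rw [Finset.sum_range_succ, ih, Finset.sum_Ioc_succ_top (Nat.zero_le n)]
      ring
  have hf0 : f 0 = x := by simp [hf, lameArc_zero hk0]
  have hfM : |f z - f M| ≤ 4 * k :=
    abs_lameArc_scaled_sub_le hk hx (Nat.cast_nonneg M) hMz hzM le_rfl
  have hlast : |(∫ t in (M : ℝ)..z, f t) - (z - M) * z| ≤ 4 * k := by
    have h1 : |∫ t in (M : ℝ)..z, (f t - z)| ≤ 4 * k * |z - M| := by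
      refine (Real.norm_eq_abs _).symm.trans_le
        (intervalIntegral.norm_integral_le_of_norm_le_const fun t ht => ?_)
      rw [Set.uIoc_of_le hMz] at ht
      have := abs_lameArc_scaled_sub_le hk hx ((Nat.cast_nonneg M).trans ht.1.le) ht.2
        (by linarith [ht.1]) le_rfl
      rw [Real.norm_eq_abs, abs_sub_comm]
      nth_rewrite 1 [← hfz]
      exact this
    rw [intervalIntegral.integral_sub (hfc.intervalIntegrable _ _) (by simp),
      intervalIntegral.integral_const, smul_eq_mul, abs_of_nonneg (by linarith : 0 ≤ z - M)] at h1
    refine h1.trans ?_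
    exact mul_le_of_le_one_right (by positivity) (by linarith)
  have hadj := intervalIntegral.integral_add_adjacent_intervals
    (hfc.intervalIntegrable (μ := MeasureTheory.volume) 0 M) (hfc.intervalIntegrable M z)
  rw [hint, ← hadj]
  rw [htrap, hf0] at hsum
  rw [hfz] at hfM
  have h1 := abs_le.1 hsum
  have h2 := abs_le.1 hfM
  have h3 := abs_le.1 hlast
  rw [abs_le]
  constructor <;> linarith

lemma sum_Icc_neg_natAbs (h : ℕ → ℕ) (N : ℕ) :
    ∑ m ∈ Finset.Icc (-N : ℤ) N, h m.natAbs = h 0 + 2 * ∑ m ∈ Finset.Ioc 0 N, h m := by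
  induction N with
  | zero => simp
  | succ n ih =>
    have hs : Finset.Icc (-(n + 1 : ℕ) : ℤ) (n + 1 : ℕ)
        = insert (-(n + 1 : ℕ) : ℤ) (insert ((n + 1 : ℕ) : ℤ) (Finset.Icc (-n : ℤ) n)) := by
      ext m
      simp only [Finset.mem_insert, Finset.mem_Icc]
      omega
    rw [hs, Finset.sum_insert, Finset.sum_insert, ih, Finset.sum_Ioc_succ_top (Nat.zero_le n),
      Int.natAbs_neg, Int.natAbs_natCast]
    · ring
    · simp
    · simp only [Finset.mem_insert, Finset.mem_Icc]
      omega

open Classical in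
lemma lameA_eq_sum {k : ℕ} (hk : k ≠ 0) {x : ℝ} (hx : 0 ≤ x) :
    lameA k x = 1 + 4 * ⌊x⌋₊ + 4 * ∑ a ∈ Finset.Ioc 0 ⌊x⌋₊, ∑ b ∈ Finset.Ioc 0 ⌊x⌋₊,
      if (a : ℝ) ^ k + (b : ℝ) ^ k ≤ x ^ k then 1 else 0 := by
  set N := ⌊x⌋₊ with hN
  set w : ℕ → ℕ → ℕ := fun a b => if (a : ℝ) ^ k + (b : ℝ) ^ k ≤ x ^ k then 1 else 0 with hw
  have hle : ∀ a : ℕ, a ≤ N → (a : ℝ) ^ k ≤ x ^ k := fun a ha => by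
    gcongr
    exact (Nat.le_floor_iff hx).1 ha
  have hbd : ∀ m : ℤ, |(m : ℝ)| ^ k ≤ x ^ k → m ∈ Finset.Icc (-N : ℤ) N := fun m hm => by
    have h1 : ((m.natAbs : ℕ) : ℝ) ≤ x := by
      rw [Nat.cast_natAbs, Int.cast_abs]
      exact (pow_le_pow_iff_left₀ (abs_nonneg _) hx hk).1 hm
    have h2 := (Nat.le_floor_iff hx).2 h1
    rw [Finset.mem_Icc]
    omega
  have hset : {q : ℤ × ℤ | |(q.1 : ℝ)| ^ k + |(q.2 : ℝ)| ^ k ≤ x ^ k}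
      = ((Finset.Icc (-N : ℤ) N ×ˢ Finset.Icc (-N : ℤ) N).filter
        fun q => |(q.1 : ℝ)| ^ k + |(q.2 : ℝ)| ^ k ≤ x ^ k : Finset (ℤ × ℤ)) := by
    ext q
    simp only [Set.mem_ofPred_eq, Finset.coe_filter, Finset.mem_product]
    refine ⟨fun h => ⟨⟨hbd _ ?_, hbd _ ?_⟩, h⟩, fun h => h.2⟩
    · linarith [pow_nonneg (abs_nonneg (q.2 : ℝ)) k]
    · linarith [pow_nonneg (abs_nonneg (q.1 : ℝ)) k]
  have hA : lameA k x = ∑ m ∈ Finset.Icc (-N : ℤ) N, ∑ n ∈ Finset.Icc (-N : ℤ) N,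
      w m.natAbs n.natAbs := by
    rw [lameA, hset, Set.ncard_coe_finset, Finset.card_filter, Finset.sum_product]
    simp only [hw, Nat.cast_natAbs, Int.cast_abs]
  have hinner : ∀ m : ℕ, ∑ n ∈ Finset.Icc (-N : ℤ) N, w m n.natAbs
      = w m 0 + 2 * ∑ b ∈ Finset.Ioc 0 N, w m b := fun m => sum_Icc_neg_natAbs (w m) N
  have h00 : w 0 0 = 1 := by simp [hw, hk, pow_nonneg hx k]
  have h0 : ∀ b ∈ Finset.Ioc 0 N, w 0 b = 1 := fun b hb => by
    have := hle b (Finset.mem_Ioc.1 hb).2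
    simp [hw, hk, this]
  have h0' : ∀ b ∈ Finset.Ioc 0 N, w b 0 = 1 := fun b hb => by
    have := hle b (Finset.mem_Ioc.1 hb).2
    simp [hw, hk, this]
  simp only [hA, hinner]
  rw [sum_Icc_neg_natAbs (fun m => w m 0 + 2 * ∑ b ∈ Finset.Ioc 0 N, w m b), h00,
    Finset.sum_congr rfl h0, Finset.sum_add_distrib, Finset.sum_congr rfl h0', ← Finset.mul_sum]
  simp only [Finset.sum_const, Nat.card_Ioc, smul_eq_mul, Nat.sub_zero, hw]
  ring

/-- Splitting a symmetric double sum along a square. -/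
lemma sum_sum_symm_split (w : ℕ → ℕ → ℕ) {M N : ℕ} (hMN : M ≤ N) (hsymm : ∀ a b, w a b = w b a)
    (hin : ∀ a ∈ Finset.Ioc 0 M, ∀ b ∈ Finset.Ioc 0 M, w a b = 1)
    (hout : ∀ a ∈ Finset.Ioc M N, ∀ b ∈ Finset.Ioc M N, w a b = 0) :
    ∑ a ∈ Finset.Ioc 0 N, ∑ b ∈ Finset.Ioc 0 N, w a b + M ^ 2
      = 2 * ∑ a ∈ Finset.Ioc 0 M, ∑ b ∈ Finset.Ioc 0 N, w a b := by
  have hsplit : ∀ g : ℕ → ℕ, ∑ a ∈ Finset.Ioc 0 N, g a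
      = ∑ a ∈ Finset.Ioc 0 M, g a + ∑ a ∈ Finset.Ioc M N, g a := fun g =>
    (Finset.sum_Ioc_consecutive g (Nat.zero_le M) hMN).symm
  have h1 : ∑ a ∈ Finset.Ioc 0 M, ∑ b ∈ Finset.Ioc 0 M, w a b = M ^ 2 := by
    rw [Finset.sum_congr rfl fun a ha => Finset.sum_congr rfl (hin a ha)]
    simp [sq]
  have h2 : ∑ a ∈ Finset.Ioc M N, ∑ b ∈ Finset.Ioc M N, w a b = 0 :=
    Finset.sum_eq_zero fun a ha => Finset.sum_eq_zero (hout a ha)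
  have h3 : ∑ a ∈ Finset.Ioc M N, ∑ b ∈ Finset.Ioc 0 M, w a b
      = ∑ a ∈ Finset.Ioc 0 M, ∑ b ∈ Finset.Ioc M N, w a b := by
    rw [Finset.sum_comm]
    exact Finset.sum_congr rfl fun a _ => Finset.sum_congr rfl fun b _ => hsymm b a
  simp only [hsplit, Finset.sum_add_distrib, h1, h2, h3]
  ring

open Classical in
lemma lameA_eq_sum_floor {k : ℕ} (hk : k ≠ 0) {x : ℝ} (hx : 0 < x) :
    (lameA k x : ℝ) = 1 + 4 * ⌊x⌋₊ + 8 * ∑ a ∈ Finset.Ioc 0 ⌊x * lameDiag k⌋₊,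
      (⌊x * lameArc k (a / x)⌋ : ℝ) - 4 * (⌊x * lameDiag k⌋₊ : ℝ) ^ 2 := by
  have hd := lameDiag_pos k
  have hz : 0 ≤ x * lameDiag k := by positivity
  have hzx : x * lameDiag k ≤ x := mul_le_of_le_one_right hx.le (lameDiag_lt_one hk).le
  have hzk : (x * lameDiag k) ^ k = x ^ k / 2 := by
    rw [mul_pow, lameDiag_pow hk]
    ring
  set M := ⌊x * lameDiag k⌋₊ with hM
  have hin : ∀ a ∈ Finset.Ioc 0 M, (a : ℝ) ^ k ≤ x ^ k / 2 := fun a ha => by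
    rw [← hzk]
    gcongr
    exact (Nat.le_floor_iff hz).1 (Finset.mem_Ioc.1 ha).2
  have hout : ∀ a ∈ Finset.Ioc M ⌊x⌋₊, x ^ k / 2 < (a : ℝ) ^ k := fun a ha => by
    rw [← hzk]
    exact pow_lt_pow_left₀ ((Nat.floor_lt hz).1 (Finset.mem_Ioc.1 ha).1) hz hk
  have hsplit := sum_sum_symm_split
    (fun a b => if (a : ℝ) ^ k + (b : ℝ) ^ k ≤ x ^ k then 1 else 0)
    (Nat.floor_mono hzx : M ≤ ⌊x⌋₊) (fun a b => by simp only [add_comm])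
    (fun a ha b hb => if_pos (by linarith [hin a ha, hin b hb]))
    (fun a ha b hb => if_neg (by linarith [hout a ha, hout b hb]))
  have hcol : ∀ a ∈ Finset.Ioc 0 M, ∑ b ∈ Finset.Ioc 0 ⌊x⌋₊,
      (if (a : ℝ) ^ k + (b : ℝ) ^ k ≤ x ^ k then 1 else 0) = ⌊x * lameArc k (a / x)⌋₊ := by
    intro a ha
    have hu : ((a : ℝ) / x) ^ k ≤ 1 := by
      rw [div_pow, div_le_one (by positivity)]
      linarith [hin a ha, pow_pos hx k]
    have hφ0 := lameArc_nonneg hu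
    have hφ1 := lameArc_le_one (by positivity : 0 ≤ (a : ℝ) / x) hu
    have hφ : (x * lameArc k (a / x)) ^ k = x ^ k - (a : ℝ) ^ k := by
      rw [mul_pow, lameArc_pow hk hu, div_pow]
      field_simp
    rw [← Finset.card_filter]
    have : (Finset.Ioc 0 ⌊x⌋₊).filter (fun b : ℕ => (a : ℝ) ^ k + (b : ℝ) ^ k ≤ x ^ k)
        = Finset.Ioc 0 ⌊x * lameArc k (a / x)⌋₊ := by
      ext b
      rw [Finset.mem_filter, Finset.mem_Ioc, Finset.mem_Ioc, Nat.le_floor_iff hx.le,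
        Nat.le_floor_iff (by positivity),
        ← pow_le_pow_iff_left₀ (Nat.cast_nonneg b) (by positivity : 0 ≤ x * lameArc k (a / x)) hk,
        hφ]
      constructor
      · rintro ⟨⟨h1, -⟩, h3⟩
        exact ⟨h1, by linarith⟩
      · rintro ⟨h1, h2⟩
        refine ⟨⟨h1, ?_⟩, by linarith⟩
        rw [← pow_le_pow_iff_left₀ (Nat.cast_nonneg b) hx.le hk]
        linarith [pow_nonneg (Nat.cast_nonneg a : (0 : ℝ) ≤ a) k]
    rw [this]
    simp
  have hfloor : ∀ a ∈ Finset.Ioc 0 M, (⌊x * lameArc k (a / x)⌋ : ℝ)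
      = ((⌊x * lameArc k (a / x)⌋₊ : ℕ) : ℝ) := fun a ha => by
    refine (natCast_floor_eq_intCast_floor (mul_nonneg hx.le (lameArc_nonneg ?_))).symm
    rw [div_pow, div_le_one (by positivity)]
    linarith [hin a ha, pow_pos hx k]
  rw [Finset.sum_congr rfl hcol] at hsplit
  rw [lameA_eq_sum hk hx.le, Finset.sum_congr rfl hfloor]
  have hsplit' := congrArg (fun n : ℕ => (n : ℝ)) hsplit
  push_cast at hsplit' ⊢
  linarith

theorem cauer_lame_estimate (k : ℕ) (hk : 3 ≤ k) :
    (fun x : ℝ => lameDelta k x) =O[atTop]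
      (fun x : ℝ => x ^ (1 - 1 / (2 * (k : ℝ) - 1))) := by
  have hk0 : k ≠ 0 := by omega
  have hk3 : (3 : ℝ) ≤ k := by exact_mod_cast hk
  obtain ⟨C, hC⟩ := exists_abs_sum_sawtooth_lameArc_le hk
  refine IsBigO.of_bound (13 + 112 * k + 8 * C) ?_
  filter_upwards [eventually_ge_atTop 1] with x hx
  have hx0 : 0 < x := by linarith
  have hX : 1 ≤ x ^ (1 - 1 / (2 * (k : ℝ) - 1)) := by
    refine Real.one_le_rpow hx ?_
    rw [sub_nonneg, div_le_one] <;> linarith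
  have hΨ := hC x hx
  set X := x ^ (1 - 1 / (2 * (k : ℝ) - 1))
  rw [Real.norm_eq_abs, Real.norm_eq_abs, abs_of_nonneg (by linarith : 0 ≤ X)]
  have hE := abs_sum_lameArc_sub_integral_le (by omega : 2 ≤ k) hx rfl
  have hz : 0 ≤ x * lameDiag k := mul_nonneg hx0.le (lameDiag_pos k).le
  have hN1 := Nat.floor_le hx0.le
  have hN2 := Nat.lt_floor_add_one x
  have hM1 := Nat.floor_le hz
  have hM2 := Nat.lt_floor_add_one (x * lameDiag k)
  have hA := lameA_eq_sum_floor hk0 hx0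
  set M := ⌊x * lameDiag k⌋₊
  set I := ∫ u in (0 : ℝ)..lameDiag k, lameArc k u
  have hfl : ∑ a ∈ Finset.Ioc 0 M, (⌊x * lameArc k (a / x)⌋ : ℝ)
      = ∑ a ∈ Finset.Ioc 0 M, x * lameArc k (a / x)
        - ∑ a ∈ Finset.Ioc 0 M, sawtooth (x * lameArc k (a / x)) - M / 2 := by
    rw [← Finset.sum_sub_distrib, eq_sub_iff_add_eq]
    have : (M : ℝ) / 2 = ∑ a ∈ Finset.Ioc 0 M, (1 / 2 : ℝ) := by
      simp
      ring
    rw [this, ← Finset.sum_add_distrib]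
    refine Finset.sum_congr rfl fun a _ => ?_
    simp only [sawtooth, Int.fract]
    ring
  set S := ∑ a ∈ Finset.Ioc 0 M, x * lameArc k (a / x)
  set Ψ := ∑ a ∈ Finset.Ioc 0 M, sawtooth (x * lameArc k (a / x))
  set e := S - (x ^ 2 * I - (x * lameDiag k - M) * (x * lameDiag k) - x / 2
    + x * lameDiag k / 2) with he
  have hΔ : lameDelta k x = 1 + 4 * (⌊x⌋₊ - x) + 4 * (x * lameDiag k - M)
      - 4 * (x * lameDiag k - M) ^ 2 - 8 * Ψ + 8 * e := by
    rw [lameDelta, lame_area_eq hk0, integral_lameArc_split hk0, hA, hfl, he]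
    ring
  have hk4 : 0 ≤ (112 * (k : ℝ)) := by positivity
  have hsq : (x * lameDiag k - M) ^ 2 ≤ 1 := pow_le_one₀ (by linarith) (by linarith)
  have hsq0 := sq_nonneg (x * lameDiag k - M)
  have hcX : 13 + 112 * (k : ℝ) ≤ (13 + 112 * k) * X := le_mul_of_one_le_right (by linarith) hX
  have h1 := abs_le.1 hΨ
  have h2 := abs_le.1 hE
  rw [hΔ, abs_le]
  constructor <;> linarith
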